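/- arXiv:2203.15391 — 2 statements merged into one kernel-verified Lean document; each statement's English description precedes it below -/
import Mathlib

section
/- Let e(t) = ξ(t) + η(t)k + ζ(t)b − x(t), where x solves the plant equation and ξ, η, ζ are the GPEBO filters. Then for every t, e satisfies the homogeneous linear time-varying differential equation ė(t) = A₀(t)e(t), where A₀(t) = A(t) − L(t)Cᵀ(t). Precisely: if for all t, x : ℝ → ℝⁿ satisfies ẋ(t) = A(t)x(t) + (Cᵀ(t)x(t))·k + u(t)·b, ξ : ℝ → ℝⁿ satisfies ξ̇(t) = A₀(t)ξ(t) + y(t)·L(t) with y(t) = Cᵀ(t)x(t), η : ℝ → ℝ^{n×n} satisfies η̇(t) = A₀(t)η(t) + y(t)·I, and ζ : ℝ → ℝ^{n×n} satisfies ζ̇(t) = A₀(t)ζ(t) + u(t)·I (all derivatives in the sense of HasDerivAt), then for all t, the function e(t) = ξ(t) + η(t)k + ζ(t)b − x(t) satisfies ė(t) = A₀(t)e(t). -/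
open Matrix

/-- The GPEBO observation error `e(t) = ξ(t) + η(t)k + ζ(t)b − x(t)` satisfies the
homogeneous LTV equation `ė(t) = A₀(t) e(t)` with `A₀(t) = A(t) − L(t)Cᵀ(t)`. -/
theorem gpebo_error_dynamics {n : ℕ}
    (A : ℝ → Matrix (Fin n) (Fin n) ℝ) (C L : ℝ → Fin n → ℝ)
    (u : ℝ → ℝ) (k b : Fin n → ℝ)
    (x ξ : ℝ → Fin n → ℝ) (η ζ : ℝ → Matrix (Fin n) (Fin n) ℝ)
    (A₀ : ℝ → Matrix (Fin n) (Fin n) ℝ)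
    (hA₀ : ∀ t, A₀ t = A t - vecMulVec (L t) (C t))
    (y : ℝ → ℝ) (hy : ∀ t, y t = C t ⬝ᵥ x t)
    (hx : ∀ t, HasDerivAt x ((A t) *ᵥ (x t) + (C t ⬝ᵥ x t) • k + u t • b) t)
    (hξ : ∀ t, HasDerivAt ξ ((A₀ t) *ᵥ (ξ t) + y t • L t) t)
    (hη : ∀ t i j, HasDerivAt (fun s => η s i j)
      ((A₀ t * η t + y t • (1 : Matrix (Fin n) (Fin n) ℝ)) i j) t)
    (hζ : ∀ t i j, HasDerivAt (fun s => ζ s i j)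
      ((A₀ t * ζ t + u t • (1 : Matrix (Fin n) (Fin n) ℝ)) i j) t) :
    ∀ t, HasDerivAt (fun s => ξ s + (η s) *ᵥ k + (ζ s) *ᵥ b - x s)
      ((A₀ t) *ᵥ (ξ t + (η t) *ᵥ k + (ζ t) *ᵥ b - x t)) t := by
  intro t
  have key : ∀ (M : ℝ → Matrix (Fin n) (Fin n) ℝ) (M' : Matrix (Fin n) (Fin n) ℝ)
      (v : Fin n → ℝ), (∀ i j, HasDerivAt (fun s => M s i j) (M' i j) t) →
      HasDerivAt (fun s => (M s) *ᵥ v) (M' *ᵥ v) t := by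
    intro M M' v h
    rw [hasDerivAt_pi]
    intro i
    simp only [mulVec, dotProduct]
    exact HasDerivAt.fun_sum fun j _ => (h i j).mul_const (v j)
  have h := (((hξ t).add (key η _ k (hη t))).add (key ζ _ b (hζ t))).sub (hx t)
  have hA : A t *ᵥ x t = A₀ t *ᵥ x t + y t • L t := by
    rw [hA₀, sub_mulVec, vecMulVec_mulVec, hy]
    ext i
    simp
  refine h.congr_deriv ?_
  rw [hA, ← hy]
  simp only [mulVec_sub, mulVec_add, add_mulVec, smul_mulVec, one_mulVec, mulVec_mulVec]
  abel
end

section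
/- (State reconstruction formula, equation (9).) Under the hypotheses of Theorem 1 — A₀ : ℝ → ℝ^{n×n} continuous, x satisfying ẋ(t) = A(t)x(t) + (Cᵀ(t)x(t))·k + u(t)·b, y(t) = Cᵀ(t)x(t), GPEBO filters ξ, η, ζ with zero initial conditions and Φ with Φ(0) = I satisfying their defining ODEs with A₀(t) = A(t) − L(t)Cᵀ(t) — the state admits, for all t ≥ 0, the exact representation x(t) = ξ(t) + η(t)k + ζ(t)b + Φ(t)x(0). Equivalently, x(t) − ξ(t) = η(t)k + ζ(t)b − Φ(t)θ with θ = −x(0). -/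
open Matrix

/-- Uniqueness of the zero solution of a linear time-varying ODE. -/
theorem linear_ode_zero {n : ℕ} (M : ℝ → Matrix (Fin n) (Fin n) ℝ) (hM : Continuous M)
    (e : ℝ → Fin n → ℝ) (he : ∀ t, HasDerivAt e (M t *ᵥ e t) t) (h0 : e 0 = 0)
    (T : ℝ) (hT : 0 ≤ T) : e T = 0 := by
  have hc : Continuous (fun s => ∑ i, ∑ j, |M s i j|) := by
    refine continuous_finsetSum _ fun i _ => continuous_finsetSum _ fun j _ => ?_
    exact (hM.matrix_elem i j).abs
  obtain ⟨K, hK⟩ := (isCompact_Icc (a := (0 : ℝ)) (b := T)).bddAbove_image hc.continuousOn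
  have hK' : ∀ t ∈ Set.Icc 0 T, ∑ i, ∑ j, |M t i j| ≤ K := fun t ht =>
    hK (Set.mem_image_of_mem _ ht)
  have hK0 : 0 ≤ K := le_trans
    (Finset.sum_nonneg fun i _ => Finset.sum_nonneg fun j _ => abs_nonneg _)
    (hK' 0 ⟨le_rfl, hT⟩)
  have hec : Continuous e := continuous_iff_continuousAt.2 fun t => (he t).continuousAt
  have key := ODE_solution_unique_of_mem_Icc_right (v := fun t z => M t *ᵥ z)
    (s := fun _ => Set.univ) (K := K.toNNReal) (a := 0) (b := T) (f := e) (g := fun _ => 0)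
    ?_ hec.continuousOn (fun t _ => (he t).hasDerivWithinAt) (fun _ _ => trivial)
    continuousOn_const ?_ (fun _ _ => trivial) h0
  · exact key ⟨hT, le_rfl⟩
  · intro t ht
    refine LipschitzOnWith.of_dist_le_mul fun p _ q _ => ?_
    rw [dist_eq_norm, dist_eq_norm, ← Matrix.mulVec_sub, Real.coe_toNNReal _ hK0]
    refine (pi_norm_le_iff_of_nonneg (by positivity)).2 fun i => ?_
    calc ‖(M t *ᵥ (p - q)) i‖ ≤ ∑ j, |M t i j| * ‖p - q‖ := by
          simp only [Matrix.mulVec, dotProduct]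
          refine (norm_sum_le (Finset.univ : Finset (Fin n))
            (fun j => M t i j * (p - q) j)).trans (Finset.sum_le_sum fun j _ => ?_)
          rw [norm_mul, Real.norm_eq_abs]
          exact mul_le_mul_of_nonneg_left (norm_le_pi_norm (p - q) j) (abs_nonneg _)
      _ = (∑ j, |M t i j|) * ‖p - q‖ := by rw [Finset.sum_mul]
      _ ≤ K * ‖p - q‖ := by
          refine mul_le_mul_of_nonneg_right (le_trans ?_ (hK' t ⟨ht.1, ht.2.le⟩)) (norm_nonneg _)
          exact Finset.single_le_sum (f := fun i => ∑ j, |M t i j|)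
            (fun i _ => Finset.sum_nonneg fun j _ => abs_nonneg _) (Finset.mem_univ i)
  · intro t _
    simpa using hasDerivWithinAt_const t (Set.Ici t) (0 : Fin n → ℝ)

/-- Componentwise derivative of a matrix gives the derivative of matrix times constant vector. -/
theorem hasDerivAt_mulVec_const {n : ℕ} (P : ℝ → Matrix (Fin n) (Fin n) ℝ)
    (P' : Matrix (Fin n) (Fin n) ℝ) (v : Fin n → ℝ) (t : ℝ)
    (h : ∀ i j, HasDerivAt (fun s => P s i j) (P' i j) t) :
    HasDerivAt (fun s => P s *ᵥ v) (P' *ᵥ v) t := by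
  refine hasDerivAt_pi.2 fun i => ?_
  simp only [Matrix.mulVec, dotProduct]
  exact HasDerivAt.fun_sum fun j _ => (h i j).mul_const (v j)

/-- State reconstruction formula (equation (9)): under the hypotheses of Theorem 1 the
state admits the exact representation `x(t) = ξ(t) + η(t)k + ζ(t)b + Φ(t)x(0)`,
equivalently `x(t) − ξ(t) = η(t)k + ζ(t)b − Φ(t)θ` with `θ = −x(0)`. -/
theorem gpebo_state_reconstruction {n : ℕ}
    (A : ℝ → Matrix (Fin n) (Fin n) ℝ) (C L : ℝ → Fin n → ℝ)
    (u : ℝ → ℝ) (k b : Fin n → ℝ)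
    (x ξ : ℝ → Fin n → ℝ) (η ζ Φ : ℝ → Matrix (Fin n) (Fin n) ℝ)
    (A₀ : ℝ → Matrix (Fin n) (Fin n) ℝ)
    (hA₀ : ∀ t, A₀ t = A t - vecMulVec (L t) (C t))
    (hA₀c : Continuous A₀)
    (y : ℝ → ℝ) (hy : ∀ t, y t = C t ⬝ᵥ x t)
    (hx : ∀ t, HasDerivAt x ((A t) *ᵥ (x t) + (C t ⬝ᵥ x t) • k + u t • b) t)
    (hξ : ∀ t, HasDerivAt ξ ((A₀ t) *ᵥ (ξ t) + y t • L t) t)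
    (hξ0 : ξ 0 = 0)
    (hη : ∀ t i j, HasDerivAt (fun s => η s i j)
      ((A₀ t * η t + y t • (1 : Matrix (Fin n) (Fin n) ℝ)) i j) t)
    (hη0 : η 0 = 0)
    (hζ : ∀ t i j, HasDerivAt (fun s => ζ s i j)
      ((A₀ t * ζ t + u t • (1 : Matrix (Fin n) (Fin n) ℝ)) i j) t)
    (hζ0 : ζ 0 = 0)
    (hΦ : ∀ t i j, HasDerivAt (fun s => Φ s i j) ((A₀ t * Φ t) i j) t)
    (hΦ0 : Φ 0 = 1)
    (θ : Fin n → ℝ) (hθ : θ = -x 0) :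
    ∀ t ≥ (0 : ℝ),
      x t = ξ t + (η t) *ᵥ k + (ζ t) *ᵥ b + (Φ t) *ᵥ (x 0) ∧
      x t - ξ t = (η t) *ᵥ k + (ζ t) *ᵥ b - (Φ t) *ᵥ θ := by
  have main : ∀ t ≥ (0 : ℝ),
      x t - (ξ t + (η t) *ᵥ k + (ζ t) *ᵥ b + (Φ t) *ᵥ (x 0)) = 0 := by
    refine linear_ode_zero A₀ hA₀c
      (fun t => x t - (ξ t + (η t) *ᵥ k + (ζ t) *ᵥ b + (Φ t) *ᵥ (x 0))) (fun t => ?_) ?_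
    · have h := (hx t).sub ((((hξ t).add (hasDerivAt_mulVec_const η _ k t (hη t))).add
        (hasDerivAt_mulVec_const ζ _ b t (hζ t))).add
        (hasDerivAt_mulVec_const Φ _ (x 0) t (hΦ t)))
      refine h.congr_deriv ?_
      have hA : A t = A₀ t + vecMulVec (L t) (C t) := by rw [hA₀ t]; abel
      rw [hA, ← hy t]
      simp only [Matrix.add_mulVec, Matrix.mulVec_sub, Matrix.mulVec_add, Matrix.smul_mulVec,
        Matrix.one_mulVec, Matrix.mulVec_mulVec, Matrix.vecMulVec_mulVec, ← hy t, op_smul_eq_smul]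
      abel
    · simp [hξ0, hη0, hζ0, hΦ0]
  intro t ht
  have h := sub_eq_zero.1 (main t ht)
  refine ⟨h, ?_⟩
  rw [hθ, Matrix.mulVec_neg]
  nth_rewrite 1 [h]
  abel
end
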